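/- arXiv:1201.5241 — 4 statements merged into one kernel-verified Lean document; each statement's English description precedes it below -/
import Mathlib

section
/- Let (c_α)_{α⊆N} be arbitrary real numbers. The determinant inequality ∏_{α⊆N} (det K_α)^{c_α} ≥ 1 holds for every n×n real symmetric positive definite matrix K if and only if ∑_{α⊆N} c_α g(α) ≥ 0 for every g ∈ con(Ψ_n). -/
open MeasureTheory

noncomputable section

/-- The principal submatrix of `K` with rows and columns indexed by `α`. -/
def principalSub {n : ℕ} (K : Matrix (Fin n) (Fin n) ℝ) (α : Finset (Fin n)) :
    Matrix {i // i ∈ α} {i // i ∈ α} ℝ :=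
  K.submatrix (fun i => i.1) (fun i => i.1)

/-- A closed convex cone: a closed convex set stable under positive scaling. -/
def IsClosedConvexCone {E : Type*} [AddCommMonoid E] [Module ℝ E] [TopologicalSpace E]
    (C : Set E) : Prop :=
  IsClosed C ∧ Convex ℝ C ∧ ∀ c : ℝ, 0 < c → ∀ x ∈ C, c • x ∈ C

/-- `ccc S` is the smallest closed convex cone containing `S`. -/
def ccc {E : Type*} [AddCommMonoid E] [Module ℝ E] [TopologicalSpace E] (S : Set E) : Set E :=
  ⋂₀ {C : Set E | IsClosedConvexCone C ∧ S ⊆ C}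

/-- `Wscale S` is the set of positive scalar multiples of elements of `S`. -/
def Wscale {E : Type*} [SMul ℝ E] (S : Set E) : Set E :=
  {h | ∃ c : ℝ, 0 < c ∧ ∃ g ∈ S, h = c • g}

/-- The rank function `φⁿᵢ`. -/
def phiFn (n : ℕ) (i : Fin n) : Finset (Fin n) → ℝ :=
  fun α => if i ∈ α then -1 else 0

/-- s-Gaussian rank functions: differential entropy functions of `n` jointly Gaussian
scalar random variables with positive definite covariance matrix. -/
def IsSGaussian (n : ℕ) (g : Finset (Fin n) → ℝ) : Prop :=
  ∃ K : Matrix (Fin n) (Fin n) ℝ, K.PosDef ∧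
    ∀ α : Finset (Fin n),
      g α = 1 / 2 * Real.logb 2
        ((2 * Real.pi * Real.exp 1) ^ α.card * (principalSub K α).det)

/-- The principal submatrix on the blocks indexed by `α`. -/
def vPrincipal {n : ℕ} {k : Fin n → ℕ}
    (K : Matrix ((i : Fin n) × Fin (k i)) ((i : Fin n) × Fin (k i)) ℝ)
    (α : Finset (Fin n)) :
    Matrix {p : (i : Fin n) × Fin (k i) // p.1 ∈ α}
      {p : (i : Fin n) × Fin (k i) // p.1 ∈ α} ℝ :=
  K.submatrix (fun p => p.1) (fun p => p.1)

/-- v-Gaussian rank functions: differential entropy functions of `n` jointly Gaussian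
random vectors of positive lengths `k i`, with positive definite joint covariance. -/
def IsVGaussian (n : ℕ) (g : Finset (Fin n) → ℝ) : Prop :=
  ∃ k : Fin n → ℕ, (∀ i, 0 < k i) ∧
    ∃ K : Matrix ((i : Fin n) × Fin (k i)) ((i : Fin n) × Fin (k i)) ℝ, K.PosDef ∧
      ∀ α : Finset (Fin n),
        g α = 1 / 2 * Real.logb 2
          ((2 * Real.pi * Real.exp 1) ^ (∑ i ∈ α, k i) * (vPrincipal K α).det)

/-- Normalised Gaussian entropy functions: all blocks have common length `T`, and the
entropy function is multiplied by `1/T`. -/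
def IsNormGaussian (n : ℕ) (g : Finset (Fin n) → ℝ) : Prop :=
  ∃ T : ℕ, 0 < T ∧
    ∃ K : Matrix (Fin n × Fin T) (Fin n × Fin T) ℝ, K.PosDef ∧
      ∀ α : Finset (Fin n),
        g α = (1 / (T : ℝ)) * (1 / 2 * Real.logb 2
          ((2 * Real.pi * Real.exp 1) ^ (T * α.card) *
            (K.submatrix (fun p : {p : Fin n × Fin T // p.1 ∈ α} => p.1)
              (fun p => p.1)).det))

/-- `g` is the differential entropy function of scalar random variables `X`:
the joint law has a density, every nonempty subtuple has a density whose entropy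
integrand is integrable, `g ∅ = 0`, and `g α = h(X_α)` (base-2). -/
def SEntropyData (n : ℕ) (Ω : Type) [MeasureSpace Ω] (X : Fin n → Ω → ℝ)
    (g : Finset (Fin n) → ℝ) : Prop :=
  IsProbabilityMeasure (volume : Measure Ω) ∧
  Measurable (fun ω i => X i ω) ∧
  (∃ f : (Fin n → ℝ) → ℝ, Measurable f ∧ (∀ x, 0 ≤ f x) ∧
    Measure.map (fun ω i => X i ω) volume
      = volume.withDensity fun x => ENNReal.ofReal (f x)) ∧
  g ∅ = 0 ∧
  ∀ α : Finset (Fin n), α.Nonempty →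
    ∃ f : ({i // i ∈ α} → ℝ) → ℝ, Measurable f ∧ (∀ x, 0 ≤ f x) ∧
      Measure.map (fun ω (i : {i // i ∈ α}) => X i.1 ω) volume
        = volume.withDensity (fun x => ENNReal.ofReal (f x)) ∧
      Integrable (fun x => f x * Real.logb 2 (f x)) ∧
      g α = -∫ x, f x * Real.logb 2 (f x)

/-- s-entropic rank functions. -/
def IsSEntropic (n : ℕ) (g : Finset (Fin n) → ℝ) : Prop :=
  ∃ (Ω : Type) (m : MeasureSpace Ω) (X : Fin n → Ω → ℝ), @SEntropyData n Ω m X g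

/-- `g` is the differential entropy function of random vectors `X i : Ω → ℝ^{k i}`. -/
def VEntropyData (n : ℕ) (k : Fin n → ℕ) (Ω : Type) [MeasureSpace Ω]
    (X : (i : Fin n) → Ω → (Fin (k i) → ℝ)) (g : Finset (Fin n) → ℝ) : Prop :=
  IsProbabilityMeasure (volume : Measure Ω) ∧
  Measurable (fun ω (i : Fin n) => X i ω) ∧
  (∃ f : ((i : Fin n) → Fin (k i) → ℝ) → ℝ, Measurable f ∧ (∀ x, 0 ≤ f x) ∧
    Measure.map (fun ω (i : Fin n) => X i ω) volume
      = volume.withDensity fun x => ENNReal.ofReal (f x)) ∧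
  g ∅ = 0 ∧
  ∀ α : Finset (Fin n), α.Nonempty →
    ∃ f : ((i : {i // i ∈ α}) → Fin (k i.1) → ℝ) → ℝ, Measurable f ∧ (∀ x, 0 ≤ f x) ∧
      Measure.map (fun ω (i : {i // i ∈ α}) => X i.1 ω) volume
        = volume.withDensity (fun x => ENNReal.ofReal (f x)) ∧
      Integrable (fun x => f x * Real.logb 2 (f x)) ∧
      g α = -∫ x, f x * Real.logb 2 (f x)

/-- v-entropic rank functions. -/
def IsVEntropic (n : ℕ) (g : Finset (Fin n) → ℝ) : Prop :=
  ∃ k : Fin n → ℕ, (∀ i, 0 < k i) ∧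
    ∃ (Ω : Type) (m : MeasureSpace Ω) (X : (i : Fin n) → Ω → (Fin (k i) → ℝ)),
      @VEntropyData n k Ω m X g

/-- s-representable rank functions. -/
def IsSRepresentable (n : ℕ) (g : Finset (Fin n) → ℝ) : Prop :=
  ∃ (k : ℕ) (A : Fin n → Fin k → ℝ),
    ∀ α : Finset (Fin n),
      g α = (Module.finrank ℝ ↥(Submodule.span ℝ (A '' (α : Set (Fin n)))) : ℝ)

/-- v-representable rank functions. -/
def IsVRepresentable (n : ℕ) (g : Finset (Fin n) → ℝ) : Prop :=
  ∃ (d : ℕ) (k : Fin n → ℕ) (A : (i : Fin n) → Fin (k i) → (Fin d → ℝ)),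
    ∀ α : Finset (Fin n),
      g α = (Module.finrank ℝ
        ↥(Submodule.span ℝ {v : Fin d → ℝ | ∃ i ∈ α, ∃ j, v = A i j}) : ℝ)

/-- The marginal probability mass function of a joint pmf `p` on the coordinates in `α`. -/
def marginalPMF {n : ℕ} (S : Fin n → ℕ) (p : ((i : Fin n) → Fin (S i)) → ℝ)
    (α : Finset (Fin n)) (x : (i : {i // i ∈ α}) → Fin (S i.1)) : ℝ :=
  ∑ y : (i : Fin n) → Fin (S i), if ∀ i : {i // i ∈ α}, y i.1 = x i then p y else 0

/-- The Shannon entropy (base 2) of the subtuple indexed by `α`. -/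
def discEntropyFn {n : ℕ} (S : Fin n → ℕ) (p : ((i : Fin n) → Fin (S i)) → ℝ)
    (α : Finset (Fin n)) : ℝ :=
  -∑ x : (i : {i // i ∈ α}) → Fin (S i.1),
    marginalPMF S p α x * Real.logb 2 (marginalPMF S p α x)

/-- Entropic rank functions: Shannon entropy functions of finitely-valued
discrete random variables. -/
def IsEntropic (n : ℕ) (g : Finset (Fin n) → ℝ) : Prop :=
  ∃ (S : Fin n → ℕ) (p : ((i : Fin n) → Fin (S i)) → ℝ),
    (∀ x, 0 ≤ p x) ∧ (∑ x, p x = 1) ∧ ∀ α, g α = discEntropyFn S p α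

/-- The Ingleton inequality for a rank function on four variables. -/
def IngletonIneq (g : Finset (Fin 4) → ℝ) (i j k l : Fin 4) : Prop :=
  g {i} + g {j} + g {k, l} + g {i, j, k} + g {i, j, l} ≤
    g {i, j} + g {i, k} + g {i, l} + g {j, k} + g {j, l}

theorem det_principalSub_pos {n : ℕ} {K : Matrix (Fin n) (Fin n) ℝ} (hK : K.PosDef)
    (α : Finset (Fin n)) : 0 < (principalSub K α).det :=
  (hK.submatrix Subtype.val_injective).det_pos

theorem subset_ccc {E : Type*} [AddCommMonoid E] [Module ℝ E] [TopologicalSpace E] (S : Set E) :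
    S ⊆ ccc S :=
  Set.subset_sInter fun _ hC => hC.2

theorem isClosedConvexCone_halfSpace {ι : Type*} [Fintype ι] (c : ι → ℝ) :
    IsClosedConvexCone {g : ι → ℝ | 0 ≤ ∑ i, c i * g i} := by
  refine ⟨isClosed_le continuous_const (by fun_prop), ?_, ?_⟩
  · refine convex_halfSpace_ge (f := fun g : ι → ℝ => ∑ i, c i * g i) ⟨?_, ?_⟩ 0
    · intro x y
      simp [mul_add, Finset.sum_add_distrib]
    · intro a x
      simp [Finset.mul_sum, mul_left_comm]
  · intro a ha x hx
    have h : ∑ i, c i * (a • x) i = a * ∑ i, c i * x i := by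
      simp [Finset.mul_sum, mul_left_comm]
    rw [Set.mem_ofPred_eq, h]
    exact mul_nonneg ha.le hx

theorem one_le_prod_rpow_iff {ι : Type*} [Fintype ι] {b : ℝ} (hb : 1 < b) (c d : ι → ℝ)
    (hd : ∀ i, 0 < d i) :
    1 ≤ ∏ i, d i ^ c i ↔ 0 ≤ ∑ i, c i * Real.logb b (d i) := by
  have hpos : ∀ i, 0 < d i ^ c i := fun i => Real.rpow_pos_of_pos (hd i) _
  rw [← Real.logb_nonneg_iff hb (Finset.prod_pos fun i _ => hpos i),
    Real.logb_prod _ _ fun i _ => (hpos i).ne']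
  simp only [Real.logb_rpow_eq_mul_logb_of_pos (hd _)]

/-- the determinant inequality `∏_α (det K_α)^(c_α) ≥ 1` holds for every
`n×n` real symmetric positive definite `K` iff `∑_α c_α g(α) ≥ 0` for every
`g ∈ con(Ψ_n)`, where `Ψ_n` is the set of log-determinant functions. -/
theorem stmt0 (n : ℕ) (c : Finset (Fin n) → ℝ) :
    (∀ K : Matrix (Fin n) (Fin n) ℝ, K.PosDef →
      1 ≤ ∏ α : Finset (Fin n), (principalSub K α).det ^ c α) ↔
    (∀ g ∈ ccc {g : Finset (Fin n) → ℝ |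
        ∃ K : Matrix (Fin n) (Fin n) ℝ, K.PosDef ∧
          ∀ α : Finset (Fin n), g α = Real.logb 2 (principalSub K α).det},
      0 ≤ ∑ α : Finset (Fin n), c α * g α) := by
  refine ⟨fun h g hg => ?_, fun h K hK => ?_⟩
  · refine hg {g | 0 ≤ ∑ α, c α * g α} ⟨isClosedConvexCone_halfSpace c, ?_⟩
    rintro g ⟨K, hK, hgK⟩
    simpa only [Set.mem_ofPred_eq, hgK] using
      (one_le_prod_rpow_iff one_lt_two c _ (det_principalSub_pos hK)).1 (h K hK)
  · exact (one_le_prod_rpow_iff one_lt_two c _ (det_principalSub_pos hK)).2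
      (h _ (subset_ccc _ ⟨K, hK, fun _ => rfl⟩))

end
end

section
/- Let A be a real n×k matrix and let α ⊆ {1,…,n} be nonempty. Let A_α be the submatrix of A consisting of the rows indexed by α. Then lim_{c→0+} [ log det( I_{|α|} + (1/c)·(A Aᵀ)_α ) / log(1/c) ] = rank(A_α), where (A Aᵀ)_α is the principal submatrix of A Aᵀ with rows and columns indexed by α. -/
open MeasureTheory

noncomputable section

open Filter Topology in
/-- For `0 ≤ l`, `log (1 + l / c) / log (1 / c)` tends to the indicator of `l ≠ 0` as `c → 0⁺`. -/
theorem tendsto_logb_one_add_div_logb {l : ℝ} (hl : 0 ≤ l) :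
    Tendsto (fun c : ℝ => Real.logb 2 (1 + c⁻¹ * l) / Real.logb 2 (1 / c))
      (𝓝[>] 0) (𝓝 (if l ≠ 0 then 1 else 0)) := by
  rcases hl.eq_or_lt with rfl | hl
  · simp
  rw [if_pos hl.ne']
  have hinv : Tendsto (fun c : ℝ => Real.logb 2 (1 / c)) (𝓝[>] 0) atTop := by
    simpa only [one_div, Function.comp_def] using
      (Real.tendsto_logb_atTop one_lt_two).comp tendsto_inv_nhdsGT_zero
  have hadd : Tendsto (fun c : ℝ => Real.logb 2 (c + l)) (𝓝[>] 0) (𝓝 (Real.logb 2 l)) := by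
    have h : Tendsto (fun c : ℝ => c + l) (𝓝 0) (𝓝 l) := by
      simpa using (tendsto_id (x := 𝓝 (0 : ℝ))).add_const l
    exact ((Real.continuousAt_log hl.ne').div_const _).tendsto.comp (h.mono_left nhdsWithin_le_nhds)
  have hlim := (hadd.div_atTop hinv).const_add 1
  rw [add_zero] at hlim
  refine hlim.congr' ?_
  filter_upwards [self_mem_nhdsWithin, hinv.eventually_gt_atTop 0] with c hc hpos
  have hc : 0 < c := hc
  have hfac : 1 + c⁻¹ * l = 1 / c * (c + l) := by field_simp
  rw [hfac, Real.logb_mul (by positivity) (by positivity), add_div, div_self hpos.ne']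

/-- The determinant of `1 + t • M` in terms of the eigenvalues of a Hermitian matrix `M`. -/
theorem Matrix.IsHermitian.det_one_add_smul {ι : Type*} [Fintype ι] [DecidableEq ι]
    {M : Matrix ι ι ℝ} (hM : M.IsHermitian) (t : ℝ) :
    (1 + t • M).det = ∏ i, (1 + t * hM.eigenvalues i) := by
  rcases eq_or_ne t 0 with rfl | ht
  · simp
  have hfac : 1 + t • M = (-t) • (Matrix.scalar ι (-t⁻¹) - M) := by
    ext i j
    simp only [Matrix.add_apply, Matrix.smul_apply, Matrix.sub_apply, Matrix.scalar_apply,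
      Matrix.diagonal_apply, Matrix.one_apply, smul_eq_mul]
    split_ifs <;> field_simp <;> ring
  rw [hfac, Matrix.det_smul, ← Matrix.eval_charpoly, hM.charpoly_eq, Polynomial.eval_prod,
    ← Finset.card_univ, ← Finset.prod_const, ← Finset.prod_mul_distrib]
  refine Finset.prod_congr rfl fun i _ => ?_
  simp only [Polynomial.eval_sub, Polynomial.eval_X, Polynomial.eval_C, RCLike.ofReal_real_eq_id,
    id_eq]
  field_simp
  ring

open Filter Topology in
/-- For positive semidefinite `M`, `log det (1 + M / c)` grows like `rank M * log (1 / c)`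
as `c → 0⁺`. -/
theorem Matrix.PosSemidef.tendsto_logb_det_div_logb {ι : Type*} [Fintype ι] [DecidableEq ι]
    {M : Matrix ι ι ℝ} (hM : M.PosSemidef) :
    Tendsto (fun c : ℝ => Real.logb 2 (1 + c⁻¹ • M).det / Real.logb 2 (1 / c))
      (𝓝[>] 0) (𝓝 (M.rank : ℝ)) := by
  have hrank : (M.rank : ℝ) = ∑ i, if hM.isHermitian.eigenvalues i ≠ 0 then (1 : ℝ) else 0 := by
    rw [hM.isHermitian.rank_eq_card_non_zero_eigs, Fintype.card_subtype, Finset.sum_boole]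
  rw [hrank]
  refine (tendsto_finsetSum _ fun i _ =>
    tendsto_logb_one_add_div_logb (hM.eigenvalues_nonneg i)).congr' ?_
  filter_upwards [self_mem_nhdsWithin] with c hc
  have hc : 0 < c := hc
  have hne : ∀ i ∈ Finset.univ, 1 + c⁻¹ * hM.isHermitian.eigenvalues i ≠ 0 := fun i _ => by
    have := hM.eigenvalues_nonneg i
    positivity
  rw [hM.isHermitian.det_one_add_smul, Real.logb_prod _ _ hne, Finset.sum_div]

/-- for a real `n×k` matrix `A` and nonempty `α ⊆ {1,…,n}`,
`lim_{c→0⁺} log₂ det(I + (1/c)·(AAᵀ)_α) / log₂(1/c) = rank(A_α)`. -/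
theorem stmt3 (n k : ℕ) (A : Matrix (Fin n) (Fin k) ℝ) (α : Finset (Fin n))
    (hα : α.Nonempty) :
    Filter.Tendsto
      (fun c : ℝ =>
        Real.logb 2 ((1 + c⁻¹ • principalSub (A * A.transpose) α).det) /
          Real.logb 2 (1 / c))
      (nhdsWithin 0 (Set.Ioi 0))
      (nhds ((A.submatrix (fun i : {i // i ∈ α} => i.1) id).rank : ℝ)) := by
  set B : Matrix {i // i ∈ α} (Fin k) ℝ := A.submatrix (fun i => i.1) id
  have hgram : principalSub (A * A.transpose) α = B * B.transpose := rfl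
  have hpos : (B * B.transpose).PosSemidef := by
    simpa using Matrix.posSemidef_self_mul_conjTranspose B
  rw [hgram, ← Matrix.rank_self_mul_transpose B]
  exact hpos.tendsto_logb_det_div_logb

end
end

section
/- The closed convex cone generated by the s-representable functions together with the functions φ^n_1,…,φ^n_n is contained in the closed convex cone generated by the s-Gaussian functions, which in turn is contained in the closed convex cone generated by the s-entropic functions: con(Ω_{s,n} ∪ {φ^n_1,…,φ^n_n}) ⊆ con(Υ_{s,n}) ⊆ con(γ*_{s,n}). -/
open MeasureTheory

noncomputable section

theorem mem_ccc_of_mem {E : Type*} [AddCommMonoid E] [Module ℝ E] [TopologicalSpace E]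
    {S : Set E} {x : E} (hx : x ∈ S) : x ∈ ccc S :=
  fun _ hC => hC.2 hx

theorem ccc_subset_ccc {E : Type*} [AddCommMonoid E] [Module ℝ E] [TopologicalSpace E]
    {S T : Set E} (h : S ⊆ ccc T) : ccc S ⊆ ccc T :=
  fun _ hx C hC => hx C ⟨hC.1, fun _ hy => h hy C hC⟩

theorem mem_ccc_of_tendsto_smul {E : Type*} [AddCommMonoid E] [Module ℝ E] [TopologicalSpace E]
    {S : Set E} {x : ℕ → E} {c : ℕ → ℝ} {y : E} (hx : ∀ m, x m ∈ S)
    (hc : ∀ᶠ m in Filter.atTop, 0 < c m)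
    (hy : Filter.Tendsto (fun m => c m • x m) Filter.atTop (nhds y)) : y ∈ ccc S := by
  intro C hC
  refine hC.1.1.mem_of_tendsto hy ?_
  filter_upwards [hc] with m hm
  exact hC.1.2.2 _ hm _ (hC.2 (hx m))

theorem phiFn_isSGaussian (n : ℕ) (i : Fin n) : IsSGaussian n (phiFn n i) := by
  classical
  have hpos : (0 : ℝ) < 2 * Real.pi * Real.exp 1 := by positivity
  refine ⟨Matrix.diagonal fun j => (2 * Real.pi * Real.exp 1)⁻¹ * if j = i then 1 / 4 else 1,
    ?_, fun α => ?_⟩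
  · rw [Matrix.posDef_diagonal_iff]
    intro j
    split_ifs <;> positivity
  · have hsub : principalSub (Matrix.diagonal fun j =>
        (2 * Real.pi * Real.exp 1)⁻¹ * if j = i then (1 / 4 : ℝ) else 1) α =
        Matrix.diagonal fun j : {j // j ∈ α} =>
          (2 * Real.pi * Real.exp 1)⁻¹ * if j.1 = i then (1 / 4 : ℝ) else 1 :=
      Matrix.submatrix_diagonal _ _ Subtype.val_injective
    rw [hsub, Matrix.det_diagonal, Finset.prod_mul_distrib, Finset.prod_const, Finset.card_univ,
      Fintype.card_coe, ← mul_assoc, ← mul_pow, mul_inv_cancel₀ hpos.ne', one_pow, one_mul,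
      Finset.prod_coe_sort α (fun j => if j = i then (1 / 4 : ℝ) else 1),
      Finset.prod_ite_eq' α i fun _ => (1 / 4 : ℝ)]
    unfold phiFn
    split_ifs
    · rw [show (1 / 4 : ℝ) = 2 ^ (-2 : ℝ) by norm_num [Real.rpow_neg],
        Real.logb_rpow (by norm_num) (by norm_num)]
      norm_num
    · simp

theorem tendsto_logb_one_add_two_pow_mul_div {l : ℝ} (hl : 0 ≤ l) :
    Filter.Tendsto (fun m : ℕ => Real.logb 2 (1 + 2 ^ m * l) / m) Filter.atTop
      (nhds (if l ≠ 0 then 1 else 0)) := by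
  split_ifs with h
  · have hl : 0 < l := lt_of_le_of_ne hl (Ne.symm h)
    have hlim : Filter.Tendsto (fun m : ℕ => Real.logb 2 ((1 / 2) ^ m + l)) Filter.atTop
        (nhds (Real.logb 2 (0 + l))) := by
      have := (tendsto_pow_atTop_nhds_zero_of_lt_one (r := (1 / 2 : ℝ)) (by norm_num)
        (by norm_num)).add_const l
      exact ((Real.continuousAt_logb (b := 2) (by simpa using h)).tendsto).comp this
    have h2 := (hlim.div_atTop tendsto_natCast_atTop_atTop).const_add 1
    rw [add_zero] at h2
    refine h2.congr' ?_
    filter_upwards [Filter.eventually_gt_atTop 0] with m hm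
    have hm' : (m : ℝ) ≠ 0 := by positivity
    have : (1 : ℝ) + 2 ^ m * l = 2 ^ m * ((1 / 2) ^ m + l) := by
      rw [mul_add, ← mul_pow]; norm_num
    rw [this, Real.logb_mul (by positivity) (by positivity), Real.logb_pow,
      Real.logb_self_eq_one (by norm_num)]
    field_simp
  · have : l = 0 := by simpa using h
    simp [this]

theorem det_one_add_smul_eq_prod_eigenvalues {ι : Type*} [Fintype ι] [DecidableEq ι]
    {G : Matrix ι ι ℝ} (hG : G.IsHermitian) (c : ℝ) :
    (1 + c • G).det = ∏ i, (1 + c * hG.eigenvalues i) := by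
  have hdiag : (1 + c • Matrix.diagonal hG.eigenvalues : Matrix ι ι ℝ) =
      Matrix.diagonal fun i => 1 + c * hG.eigenvalues i := by
    ext i j
    by_cases h : i = j <;> simp [h]
  rw [← Matrix.det_diagonal, ← hdiag]
  conv_lhs =>
    rw [hG.spectral_theorem,
      ← map_one (Unitary.conjStarAlgAut ℝ (Matrix ι ι ℝ) hG.eigenvectorUnitary), ← map_smul,
      ← map_add, Unitary.conjStarAlgAut_apply, Matrix.det_mul_right_comm]
  simp

theorem tendsto_logb_det_one_add_two_pow_smul_div {ι : Type*} [Fintype ι] [DecidableEq ι]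
    {G : Matrix ι ι ℝ} (hG : G.PosSemidef) :
    Filter.Tendsto (fun m : ℕ => Real.logb 2 (1 + (2 : ℝ) ^ m • G).det / m) Filter.atTop
      (nhds G.rank) := by
  have hsum := tendsto_finsetSum Finset.univ fun i _ =>
    tendsto_logb_one_add_two_pow_mul_div (hG.eigenvalues_nonneg i)
  rw [hG.1.rank_eq_card_non_zero_eigs, Fintype.card_subtype, Finset.natCast_card_filter]
  refine hsum.congr fun m => ?_
  rw [det_one_add_smul_eq_prod_eigenvalues hG.1, Real.logb_prod, Finset.sum_div]
  intro i _
  have := hG.eigenvalues_nonneg i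
  positivity

theorem principalSub_mul_transpose_rank {n k : ℕ} (A : Fin n → Fin k → ℝ) (α : Finset (Fin n)) :
    (principalSub (Matrix.of A * (Matrix.of A).transpose) α).rank =
      Module.finrank ℝ ↥(Submodule.span ℝ (A '' (α : Set (Fin n)))) := by
  have hsub : principalSub (Matrix.of A * (Matrix.of A).transpose) α =
      (Matrix.of fun i : {i // i ∈ α} => A i.1) *
        (Matrix.of fun i : {i // i ∈ α} => A i.1).transpose := rfl
  rw [hsub, Matrix.rank_self_mul_transpose, Matrix.rank_eq_finrank_span_row]
  have hrange : Set.range (Matrix.of fun i : {i // i ∈ α} => A i.1).row =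
      A '' (α : Set (Fin n)) := by
    ext v
    refine ⟨?_, ?_⟩
    · rintro ⟨i, rfl⟩
      exact ⟨i.1, i.2, rfl⟩
    · rintro ⟨i, hi, rfl⟩
      exact ⟨⟨i, hi⟩, rfl⟩
  rw [hrange]

theorem isSRepresentable_mem_ccc {n : ℕ} {g : Finset (Fin n) → ℝ} (hg : IsSRepresentable n g) :
    g ∈ ccc {g : Finset (Fin n) → ℝ | IsSGaussian n g} := by
  obtain ⟨k, A, hA⟩ := hg
  have hpos : (0 : ℝ) < 2 * Real.pi * Real.exp 1 := by positivity
  set G := Matrix.of A * (Matrix.of A).transpose with hG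
  have hGpos : G.PosSemidef := by
    simpa using Matrix.posSemidef_self_mul_conjTranspose (Matrix.of A)
  refine mem_ccc_of_tendsto_smul
    (x := fun m α => 1 / 2 * Real.logb 2 (1 + (2 : ℝ) ^ m • principalSub G α).det)
    (c := fun m => 2 / m) (fun m => ?_) ?_ ?_
  · refine ⟨(2 * Real.pi * Real.exp 1)⁻¹ • (1 + (2 : ℝ) ^ m • G), ?_, fun α => ?_⟩
    · exact (Matrix.PosDef.one.add_posSemidef (hGpos.smul (by positivity))).smul (by positivity)
    · have hsub : principalSub ((2 * Real.pi * Real.exp 1)⁻¹ • (1 + (2 : ℝ) ^ m • G)) α =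
          (2 * Real.pi * Real.exp 1)⁻¹ • (1 + (2 : ℝ) ^ m • principalSub G α) := by
        ext i j
        simp only [principalSub, Matrix.submatrix_apply, Matrix.smul_apply, Matrix.add_apply,
          Matrix.one_apply, Subtype.ext_iff]
      rw [hsub, Matrix.det_smul, Fintype.card_coe, ← mul_assoc, ← mul_pow,
        mul_inv_cancel₀ hpos.ne', one_pow, one_mul]
  · filter_upwards [Filter.eventually_gt_atTop 0] with m hm
    positivity
  · rw [tendsto_pi_nhds]
    intro α
    rw [hA α, ← principalSub_mul_transpose_rank]
    refine (tendsto_logb_det_one_add_two_pow_smul_div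
      (G := principalSub G α) (hGpos.submatrix _)).congr fun m => ?_
    simp only [Pi.smul_apply, smul_eq_mul]
    ring

section GaussianDensity

open ProbabilityTheory
open scoped MatrixOrder

theorem pi_gaussianReal_eq_withDensity {ι : Type*} [Fintype ι] :
    Measure.pi (fun _ : ι => gaussianReal 0 1) =
      volume.withDensity fun x => ENNReal.ofReal (∏ i, gaussianPDFReal 0 1 (x i)) := by
  refine Measure.pi_eq fun s hs => ?_
  have hint : ∀ i, Integrable ((s i).indicator (gaussianPDFReal 0 1)) := fun i =>
    (integrable_gaussianPDFReal 0 1).indicator (hs i)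
  have hnn : ∀ i x, 0 ≤ (s i).indicator (gaussianPDFReal 0 1) x := fun i =>
    Set.indicator_nonneg fun x _ => gaussianPDFReal_nonneg 0 1 x
  rw [withDensity_apply _ (MeasurableSet.univ_pi hs),
    ← lintegral_indicator (MeasurableSet.univ_pi hs)]
  have hprod : (Set.univ.pi s).indicator
      (fun x => ENNReal.ofReal (∏ i, gaussianPDFReal 0 1 (x i))) =
      fun x => ENNReal.ofReal (∏ i, (s i).indicator (gaussianPDFReal 0 1) (x i)) := by
    ext x
    by_cases hx : x ∈ Set.univ.pi s
    · rw [Set.indicator_of_mem hx]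
      congr 1
      exact Finset.prod_congr rfl fun i _ => (Set.indicator_of_mem (hx i trivial) _).symm
    · rw [Set.indicator_of_notMem hx]
      simp only [Set.mem_univ_pi, not_forall] at hx
      obtain ⟨i, hi⟩ := hx
      rw [Finset.prod_eq_zero (Finset.mem_univ i) (Set.indicator_of_notMem hi _),
        ENNReal.ofReal_zero]
  simp only [hprod]
  rw [volume_pi, ← ofReal_integral_eq_lintegral_ofReal (Integrable.fintype_prod hint)
      (ae_of_all _ fun x => Finset.prod_nonneg fun i _ => hnn i _),
    integral_fintype_prod_eq_prod (fun i => (s i).indicator (gaussianPDFReal 0 1)),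
    ENNReal.ofReal_prod_of_nonneg fun i _ => integral_nonneg (hnn i)]
  refine Finset.prod_congr rfl fun i _ => ?_
  rw [integral_indicator (hs i), gaussianReal_apply_eq_integral 0 one_ne_zero]

theorem map_withDensity_comp {α β : Type*} [MeasurableSpace α] [MeasurableSpace β]
    (μ : Measure α) {T : α → β} (hT : Measurable T) {f : β → ENNReal} (hf : Measurable f) :
    (μ.withDensity (f ∘ T)).map T = (μ.map T).withDensity f := by
  ext s hs
  rw [Measure.map_apply hT hs, withDensity_apply _ (hT hs), withDensity_apply _ hs,
    setLIntegral_map hs hf hT]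
  rfl

theorem measurable_mulVec {ι : Type*} [Fintype ι] (C : Matrix ι ι ℝ) : Measurable C.mulVec := by
  have : Continuous (fun x => C.mulVec x) := by fun_prop
  exact this.measurable

/-- The density of the image of the standard Gaussian measure under an invertible matrix `C`. -/
def gaussianDensity {ι : Type*} [Fintype ι] [DecidableEq ι] (C : Matrix ι ι ℝ) (x : ι → ℝ) : ℝ :=
  |C.det⁻¹| * ∏ i, gaussianPDFReal 0 1 (C⁻¹.mulVec x i)

theorem gaussianDensity_nonneg {ι : Type*} [Fintype ι] [DecidableEq ι] (C : Matrix ι ι ℝ)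
    (x : ι → ℝ) : 0 ≤ gaussianDensity C x :=
  mul_nonneg (abs_nonneg _) (Finset.prod_nonneg fun _ _ => gaussianPDFReal_nonneg _ _ _)

theorem measurable_gaussianDensity {ι : Type*} [Fintype ι] [DecidableEq ι] (C : Matrix ι ι ℝ) :
    Measurable (gaussianDensity C) := by
  unfold gaussianDensity
  refine Measurable.const_mul (Finset.measurable_prod _ fun i _ => ?_) _
  exact (measurable_gaussianPDFReal 0 1).comp
    ((measurable_pi_apply i).comp (measurable_mulVec C⁻¹))

theorem map_mulVec_pi_gaussianReal {ι : Type*} [Fintype ι] [DecidableEq ι] {C : Matrix ι ι ℝ}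
    (hC : C.det ≠ 0) :
    (Measure.pi (fun _ : ι => gaussianReal 0 1)).map C.mulVec =
      volume.withDensity fun x => ENNReal.ofReal (gaussianDensity C x) := by
  set f : (ι → ℝ) → ENNReal := fun x =>
    ENNReal.ofReal (∏ i, gaussianPDFReal 0 1 (C⁻¹.mulVec x i)) with hf
  have hfm : Measurable f := by
    refine ENNReal.measurable_ofReal.comp (Finset.measurable_prod _ fun i _ => ?_)
    exact (measurable_gaussianPDFReal 0 1).comp
      ((measurable_pi_apply i).comp (measurable_mulVec C⁻¹))
  have hcomp : (fun x : ι → ℝ => ENNReal.ofReal (∏ i, gaussianPDFReal 0 1 (x i))) =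
      f ∘ C.mulVec := by
    ext x
    simp [hf, Matrix.mulVec_mulVec, Matrix.nonsing_inv_mul C (isUnit_iff_ne_zero.mpr hC)]
  have hvol := Real.map_matrix_volume_pi_eq_smul_volume_pi hC
  rw [show ⇑(Matrix.toLin' C) = C.mulVec from rfl] at hvol
  rw [pi_gaussianReal_eq_withDensity, hcomp, map_withDensity_comp _ (measurable_mulVec C) hfm, hvol,
    withDensity_smul_measure, ← withDensity_smul _ hfm]
  congr 1
  ext x
  simp only [gaussianDensity, Pi.smul_apply, smul_eq_mul, hf]
  rw [ENNReal.ofReal_mul (abs_nonneg _)]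

theorem logb_gaussianPDFReal (z : ℝ) :
    Real.logb 2 (gaussianPDFReal 0 1 z) =
      -(1 / 2 * Real.logb 2 (2 * Real.pi)) - z ^ 2 * (1 / 2 * Real.logb 2 (Real.exp 1)) := by
  have h : (0 : ℝ) < 2 * Real.pi := by positivity
  rw [gaussianPDFReal, Real.logb_mul (by simp; positivity) (Real.exp_ne_zero _), Real.logb_inv,
    Real.sqrt_eq_rpow, Real.logb_rpow_eq_mul_logb_of_pos (by simpa using h)]
  simp only [Real.logb, Real.log_exp, NNReal.coe_one, mul_one, sub_zero]
  ring

theorem integrable_sq_gaussianReal : Integrable (fun z : ℝ => z ^ 2) (gaussianReal 0 1) :=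
  (memLp_id_gaussianReal (μ := 0) (v := 1) 2).integrable_sq

theorem integral_sq_gaussianReal : ∫ z : ℝ, z ^ 2 ∂(gaussianReal 0 1) = 1 := by
  have h := variance_id_gaussianReal (μ := 0) (v := 1)
  rw [variance_of_integral_eq_zero aemeasurable_id (by simp)] at h
  simpa using h

theorem integrable_logb_gaussianPDFReal :
    Integrable (fun z : ℝ => Real.logb 2 (gaussianPDFReal 0 1 z)) (gaussianReal 0 1) := by
  simp_rw [logb_gaussianPDFReal]
  exact (integrable_const _).sub (integrable_sq_gaussianReal.mul_const _)

theorem integral_logb_gaussianPDFReal :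
    ∫ z : ℝ, Real.logb 2 (gaussianPDFReal 0 1 z) ∂(gaussianReal 0 1) =
      -(1 / 2 * Real.logb 2 (2 * Real.pi * Real.exp 1)) := by
  simp_rw [logb_gaussianPDFReal]
  rw [integral_sub (integrable_const _) (integrable_sq_gaussianReal.mul_const _),
    integral_mul_const, integral_sq_gaussianReal,
    Real.logb_mul (by positivity) (Real.exp_ne_zero 1)]
  simp
  ring

theorem logb_gaussianDensity_mulVec {ι : Type*} [Fintype ι] [DecidableEq ι] {C : Matrix ι ι ℝ}
    (hC : C.det ≠ 0) (z : ι → ℝ) :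
    Real.logb 2 (gaussianDensity C (C.mulVec z)) =
      -Real.logb 2 C.det + ∑ i, Real.logb 2 (gaussianPDFReal 0 1 (z i)) := by
  have hpos : ∀ i, gaussianPDFReal 0 1 (z i) ≠ 0 := fun i =>
    (gaussianPDFReal_pos 0 1 (z i) one_ne_zero).ne'
  rw [gaussianDensity, Matrix.mulVec_mulVec,
    Matrix.nonsing_inv_mul C (isUnit_iff_ne_zero.mpr hC), Matrix.one_mulVec,
    Real.logb_mul (by simpa using hC) (Finset.prod_ne_zero_iff.mpr fun i _ => hpos i),
    Real.logb_abs, Real.logb_inv, Real.logb_prod _ _ fun i _ => hpos i]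

theorem integrable_and_integral_gaussianDensity_mul_logb {ι : Type*} [Fintype ι] [DecidableEq ι]
    {C : Matrix ι ι ℝ} (hC : C.det ≠ 0) :
    Integrable (fun x => gaussianDensity C x * Real.logb 2 (gaussianDensity C x)) ∧
      -∫ x, gaussianDensity C x * Real.logb 2 (gaussianDensity C x) =
        1 / 2 * Real.logb 2 ((2 * Real.pi * Real.exp 1) ^ Fintype.card ι * (C * C).det) := by
  have hfm := measurable_gaussianDensity C
  have hsmul : (fun x => gaussianDensity C x * Real.logb 2 (gaussianDensity C x)) = fun x =>
      (ENNReal.ofReal (gaussianDensity C x)).toReal • Real.logb 2 (gaussianDensity C x) := by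
    ext x
    rw [ENNReal.toReal_ofReal (gaussianDensity_nonneg C x), smul_eq_mul]
  have hlog : Measurable fun x => Real.logb 2 (gaussianDensity C x) := by
    unfold Real.logb
    fun_prop
  have hterm : ∀ i, Integrable (fun z : ι → ℝ => Real.logb 2 (gaussianPDFReal 0 1 (z i)))
      (Measure.pi fun _ => gaussianReal 0 1) := fun i =>
    integrable_comp_eval (μ := fun _ : ι => gaussianReal 0 1) integrable_logb_gaussianPDFReal
  have hsum := integrable_finsetSum Finset.univ fun i _ => hterm i
  constructor
  · rw [hsmul, ← integrable_withDensity_iff_integrable_smul' (by fun_prop) (by simp),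
      ← map_mulVec_pi_gaussianReal hC,
      integrable_map_measure hlog.aestronglyMeasurable (measurable_mulVec C).aemeasurable]
    simp only [Function.comp_def, logb_gaussianDensity_mulVec hC]
    exact (integrable_const _).add hsum
  · rw [hsmul, ← integral_withDensity_eq_integral_toReal_smul (by fun_prop) (by simp),
      ← map_mulVec_pi_gaussianReal hC,
      integral_map (measurable_mulVec C).aemeasurable hlog.aestronglyMeasurable]
    simp only [logb_gaussianDensity_mulVec hC]
    rw [integral_add (integrable_const _) hsum, integral_finsetSum _ fun i _ => hterm i]
    have hev : ∀ i : ι, ∫ z : ι → ℝ, Real.logb 2 (gaussianPDFReal 0 1 (z i))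
        ∂(Measure.pi fun _ => gaussianReal 0 1) =
        -(1 / 2 * Real.logb 2 (2 * Real.pi * Real.exp 1)) := fun i => by
      rw [← integral_logb_gaussianPDFReal]
      exact integral_comp_eval (μ := fun _ : ι => gaussianReal 0 1)
        integrable_logb_gaussianPDFReal.aestronglyMeasurable
    simp only [hev]
    rw [Real.logb_mul (x := _ ^ _) (by positivity) (by simp [hC]), Real.logb_pow, Matrix.det_mul,
      Real.logb_mul hC hC]
    simp
    ring

theorem multivariateGaussian_map_ofLp {ι : Type*} [Fintype ι] [DecidableEq ι]
    (S : Matrix ι ι ℝ) :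
    (multivariateGaussian 0 S).map (WithLp.ofLp) =
      (Measure.pi fun _ => gaussianReal 0 1).map (CFC.sqrt S).mulVec := by
  rw [multivariateGaussian, ← map_pi_eq_stdGaussian, Measure.map_map (by fun_prop) (by fun_prop),
    Measure.map_map (by fun_prop) (by fun_prop)]
  congr 1
  ext x i
  simp

theorem multivariateGaussian_map_comp {ι κ : Type*} [Fintype ι] [DecidableEq ι] [Fintype κ]
    [DecidableEq κ] {S : Matrix ι ι ℝ} (hS : S.PosSemidef) (e : κ → ι) :
    (multivariateGaussian 0 S).map (fun x i => x (e i)) =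
      (multivariateGaussian 0 (S.submatrix e e)).map WithLp.ofLp := by
  let L : EuclideanSpace ℝ ι →L[ℝ] EuclideanSpace ℝ κ :=
    LinearMap.toContinuousLinearMap
      { toFun := fun x => WithLp.toLp 2 fun i => x (e i)
        map_add' := fun _ _ => rfl
        map_smul' := fun _ _ => rfl }
  have hL : (multivariateGaussian 0 S).map L = multivariateGaussian 0 (S.submatrix e e) := by
    apply IsGaussian.ext
    · simp only [id_eq, integral_id_multivariateGaussian]
      rw [ContinuousLinearMap.integral_id_map, integral_id_multivariateGaussian, map_zero]
      exact IsGaussian.integrable_id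
    rw [← ContinuousLinearMap.toBilinForm_inj]
    refine LinearMap.BilinForm.ext_basis (EuclideanSpace.basisFun κ ℝ).toBasis fun i j ↦ ?_
    rw [ContinuousLinearMap.toBilinForm_apply, ContinuousLinearMap.toBilinForm_apply,
      covarianceBilin_apply_eq_cov, covariance_map]
    · have (i : κ) : (fun u => inner ℝ ((EuclideanSpace.basisFun κ ℝ).toBasis i) u) ∘ L =
          fun u => u (e i) := by
        ext
        simp [L, PiLp.inner_apply]
        rfl
      simp_rw [this, covariance_eval_multivariateGaussian hS,
        covarianceBilin_multivariateGaussian (hS.submatrix _)]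
      simp
    any_goals exact Measurable.aestronglyMeasurable (by fun_prop)
    · fun_prop
    · exact IsGaussian.memLp_two_id
  rw [← hL, Measure.map_map (by fun_prop) (by fun_prop)]
  rfl

theorem isSGaussian_isSEntropic {n : ℕ} {g : Finset (Fin n) → ℝ} (hg : IsSGaussian n g) :
    IsSEntropic n g := by
  obtain ⟨K, hK, hg⟩ := hg
  have key : ∀ {ι : Type} [Fintype ι] [DecidableEq ι] (e : ι → Fin n), Function.Injective e →
      (CFC.sqrt (K.submatrix e e)).det ≠ 0 ∧
        CFC.sqrt (K.submatrix e e) * CFC.sqrt (K.submatrix e e) = K.submatrix e e := by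
    intro ι _ _ e he
    have hpd := hK.submatrix he
    have hsq := CFC.sqrt_mul_sqrt_self (K.submatrix e e) hpd.posSemidef.nonneg
    refine ⟨fun h => hpd.det_pos.ne' ?_, hsq⟩
    rw [← hsq, Matrix.det_mul, h, zero_mul]
  have dens : ∀ {ι : Type} [Fintype ι] [DecidableEq ι] (e : ι → Fin n) (he : Function.Injective e),
      (multivariateGaussian 0 K).map (fun x i => x (e i)) =
        volume.withDensity fun x =>
          ENNReal.ofReal (gaussianDensity (CFC.sqrt (K.submatrix e e)) x) := fun e he => by
    rw [multivariateGaussian_map_comp hK.posSemidef, multivariateGaussian_map_ofLp,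
      map_mulVec_pi_gaussianReal (key e he).1]
  refine ⟨EuclideanSpace ℝ (Fin n), ⟨multivariateGaussian 0 K⟩,
    fun i ω => ω i, ?_, ?_, ⟨_, measurable_gaussianDensity _, gaussianDensity_nonneg _,
      dens id Function.injective_id⟩, ?_, fun α hα => ?_⟩
  · change IsProbabilityMeasure (multivariateGaussian 0 K)
    infer_instance
  · fun_prop
  · simp [hg ∅]
  · have hent := integrable_and_integral_gaussianDensity_mul_logb
      (key (fun i : {i // i ∈ α} => i.1) Subtype.val_injective).1
    refine ⟨_, measurable_gaussianDensity _, gaussianDensity_nonneg _,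
      dens (fun i : {i // i ∈ α} => i.1) Subtype.val_injective, hent.1, ?_⟩
    rw [hent.2, (key _ Subtype.val_injective).2, hg α, Fintype.card_coe]
    rfl

end GaussianDensity

/-- `con(Ω_{s,n} ∪ {φⁿ₁,…,φⁿₙ}) ⊆ con(Υ_{s,n}) ⊆ con(γ*_{s,n})`. -/
theorem stmt6 (n : ℕ) :
    ccc ({g : Finset (Fin n) → ℝ | IsSRepresentable n g} ∪
        {g | ∃ i : Fin n, g = phiFn n i}) ⊆
      ccc {g : Finset (Fin n) → ℝ | IsSGaussian n g} ∧
    ccc {g : Finset (Fin n) → ℝ | IsSGaussian n g} ⊆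
      ccc {g : Finset (Fin n) → ℝ | IsSEntropic n g} := by
  refine ⟨ccc_subset_ccc ?_, ccc_subset_ccc fun g hg => mem_ccc_of_mem ?_⟩
  · rintro g (hg | ⟨i, rfl⟩)
    · exact isSRepresentable_mem_ccc hg
    · exact mem_ccc_of_mem (phiFn_isSGaussian n i)
  · exact isSGaussian_isSEntropic hg

end
end

section
/- If g_1 and g_2 are v-Gaussian functions and ℓ_1, ℓ_2 are positive integers, then ℓ_1·g_1 + ℓ_2·g_2 is a v-Gaussian function. -/
open MeasureTheory

noncomputable section

/-- A block diagonal matrix with positive definite blocks is positive definite. -/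
lemma posDef_fromBlocks_zero {m m' : Type*} [Fintype m] [Fintype m']
    {A : Matrix m m ℝ} {B : Matrix m' m' ℝ} (hA : A.PosDef) (hB : B.PosDef) :
    (Matrix.fromBlocks A 0 0 B).PosDef := by
  refine .of_dotProduct_mulVec_pos
    (hA.isHermitian.fromBlocks (by simp) hB.isHermitian) fun x hx => ?_
  obtain ⟨y, z, rfl⟩ : ∃ y z, x = Sum.elim y z :=
    ⟨x ∘ Sum.inl, x ∘ Sum.inr, (Sum.elim_comp_inl_inr x).symm⟩
  have hsum : star (Sum.elim y z) ⬝ᵥ (Matrix.fromBlocks A 0 0 B).mulVec (Sum.elim y z)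
      = star y ⬝ᵥ A.mulVec y + star z ⬝ᵥ B.mulVec z := by
    simp [Matrix.fromBlocks_mulVec, dotProduct]
  rw [hsum]
  by_cases hy : y = 0
  · have hz : z ≠ 0 := by
      rintro rfl
      exact hx (by rw [hy, Sum.elim_zero_zero])
    exact add_pos_of_nonneg_of_pos (hA.posSemidef.dotProduct_mulVec_nonneg y)
      (hB.dotProduct_mulVec_pos hz)
  · exact add_pos_of_pos_of_nonneg (hA.dotProduct_mulVec_pos hy)
      (hB.posSemidef.dotProduct_mulVec_nonneg z)

/-- Concatenating, block by block, vectors of lengths `k₁ i` and `k₂ i`. -/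
def sigmaFinAddEquiv {n : ℕ} (k₁ k₂ : Fin n → ℕ) :
    ((i : Fin n) × Fin (k₁ i + k₂ i)) ≃
      ((i : Fin n) × Fin (k₁ i)) ⊕ ((i : Fin n) × Fin (k₂ i)) :=
  (Equiv.sigmaCongrRight fun _ => finSumFinEquiv.symm).trans (Equiv.sigmaSumDistrib _ _)

lemma elim_fst_sigmaFinAddEquiv {n : ℕ} (k₁ k₂ : Fin n → ℕ)
    (p : (i : Fin n) × Fin (k₁ i + k₂ i)) :
    Sum.elim Sigma.fst Sigma.fst (sigmaFinAddEquiv k₁ k₂ p) = p.1 := by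
  obtain ⟨i, j⟩ := p
  obtain ⟨j, rfl⟩ := finSumFinEquiv.surjective j
  cases j <;> simp [sigmaFinAddEquiv, Equiv.sigmaSumDistrib]

/-- The principal minors of a block diagonal matrix are products of principal minors. -/
lemma det_vPrincipal_fromBlocks {n : ℕ} {k₁ k₂ : Fin n → ℕ}
    (A : Matrix ((i : Fin n) × Fin (k₁ i)) ((i : Fin n) × Fin (k₁ i)) ℝ)
    (B : Matrix ((i : Fin n) × Fin (k₂ i)) ((i : Fin n) × Fin (k₂ i)) ℝ)
    (α : Finset (Fin n)) :
    (vPrincipal ((Matrix.fromBlocks A 0 0 B).submatrix (sigmaFinAddEquiv k₁ k₂)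
      (sigmaFinAddEquiv k₁ k₂)) α).det = (vPrincipal A α).det * (vPrincipal B α).det := by
  let e : {p : (i : Fin n) × Fin (k₁ i + k₂ i) // p.1 ∈ α} ≃
      {p : (i : Fin n) × Fin (k₁ i) // p.1 ∈ α} ⊕ {p : (i : Fin n) × Fin (k₂ i) // p.1 ∈ α} :=
    ((sigmaFinAddEquiv k₁ k₂).subtypeEquiv (q := fun s => Sum.elim Sigma.fst Sigma.fst s ∈ α)
      fun p => by rw [elim_fst_sigmaFinAddEquiv]).trans Equiv.subtypeSum
  rw [← Matrix.det_fromBlocks_zero₂₁ (vPrincipal A α) 0 (vPrincipal B α),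
    ← Matrix.det_submatrix_equiv_self e]
  congr 1
  have he : ∀ p, sigmaFinAddEquiv k₁ k₂ p.1 = Sum.map Subtype.val Subtype.val (e p) := by
    intro p
    obtain ⟨q, rfl⟩ := e.symm.surjective p
    rw [Equiv.apply_symm_apply]
    cases q <;> simp [e, Equiv.subtypeSum]
  ext p q
  simp only [vPrincipal, Matrix.submatrix_apply, he]
  cases e p <;> cases e q <;> simp

lemma det_vPrincipal_pos {n : ℕ} {k : Fin n → ℕ}
    {K : Matrix ((i : Fin n) × Fin (k i)) ((i : Fin n) × Fin (k i)) ℝ} (hK : K.PosDef)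
    (α : Finset (Fin n)) : 0 < (vPrincipal K α).det :=
  (hK.submatrix Subtype.val_injective).det_pos

/-- Concatenating independent Gaussian vectors adds their entropy functions. -/
lemma IsVGaussian.add {n : ℕ} {g₁ g₂ : Finset (Fin n) → ℝ}
    (h₁ : IsVGaussian n g₁) (h₂ : IsVGaussian n g₂) :
    IsVGaussian n (fun α => g₁ α + g₂ α) := by
  obtain ⟨k₁, hk₁, A, hA, hg₁⟩ := h₁
  obtain ⟨k₂, -, B, hB, hg₂⟩ := h₂
  refine ⟨fun i => k₁ i + k₂ i, fun i => Nat.add_pos_left (hk₁ i) _, _,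
    (posDef_fromBlocks_zero hA hB).submatrix (sigmaFinAddEquiv k₁ k₂).injective, fun α => ?_⟩
  have hA' := det_vPrincipal_pos hA α
  have hB' := det_vPrincipal_pos hB α
  rw [det_vPrincipal_fromBlocks]
  beta_reduce
  rw [hg₁, hg₂, ← mul_add, ← Real.logb_mul (by positivity) (by positivity),
    Finset.sum_add_distrib, pow_add, mul_mul_mul_comm]

lemma IsVGaussian.natCast_mul {n : ℕ} {g : Finset (Fin n) → ℝ} (h : IsVGaussian n g)
    {m : ℕ} (hm : 0 < m) : IsVGaussian n (fun α => (m : ℝ) * g α) := by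
  induction m, hm using Nat.le_induction with
  | base => simpa using h
  | succ m _ ih => simpa [add_mul] using ih.add h

/-- if `g₁, g₂` are v-Gaussian and `ℓ₁, ℓ₂` are positive integers, then
`ℓ₁·g₁ + ℓ₂·g₂` is v-Gaussian. -/
theorem stmt9 (n : ℕ) (g₁ g₂ : Finset (Fin n) → ℝ)
    (h₁ : IsVGaussian n g₁) (h₂ : IsVGaussian n g₂)
    (ℓ₁ ℓ₂ : ℕ) (hℓ₁ : 0 < ℓ₁) (hℓ₂ : 0 < ℓ₂) :
    IsVGaussian n (fun α => (ℓ₁ : ℝ) * g₁ α + (ℓ₂ : ℝ) * g₂ α) := by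
  exact (h₁.natCast_mul hℓ₁).add (h₂.natCast_mul hℓ₂)

end
end
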